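/- If a Markov transition kernel K on [0,∞) satisfies the regularity condition, then so does every m-step transition kernel K^m (m ≥ 1): for every nonnegative function u_t = u(t) with u_t → 0 as t → ∞, the measures K^m(tu_t, t·) converge weakly to δ_0 on [0,∞]. -/

import Mathlib

open MeasureTheory ProbabilityTheory Filter Topology
open scoped NNReal ENNReal

noncomputable section

/-- The regularity condition: `K(t u_t, t·)` converges weakly on `[0,∞]` to the point
mass `δ_0` as `t → ∞`, for every nonnegative function `u_t → 0`. -/
def RegCond (K : Kernel ℝ≥0 ℝ≥0) : Prop :=
  ∀ u : ℝ≥0 → ℝ≥0, Tendsto u atTop (𝓝 0) →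
    ∀ f : C(ℝ≥0∞, ℝ),
      Tendsto (fun t : ℝ≥0 => ∫ x, f ((x / t : ℝ≥0) : ℝ≥0∞) ∂(K (t * u t)))
        atTop (𝓝 (f 0))

/-- The `m`-step transition kernel: `K^0 = id`, `K^{m+1}(x,A) = ∫ K^m(x,dv) K(v,A)`. -/
def kpow (K : Kernel ℝ≥0 ℝ≥0) : ℕ → Kernel ℝ≥0 ℝ≥0
  | 0 => Kernel.id
  | n + 1 => K ∘ₖ kpow K n

/-- If `F t (u t)` converges to `c` along every selection `u` tending to `0`, then `F` converges
to `c` jointly along `atTop ×ˢ 𝓝 0`. -/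
theorem tendsto_prod_of_forall_selection {F : ℝ≥0 → ℝ≥0 → ℝ} {c : ℝ}
    (h : ∀ u : ℝ≥0 → ℝ≥0, Tendsto u atTop (𝓝 0) → Tendsto (fun t => F t (u t)) atTop (𝓝 c)) :
    Tendsto (fun p : ℝ≥0 × ℝ≥0 => F p.1 p.2) (atTop ×ˢ 𝓝 0) (𝓝 c) := by
  classical
  by_contra hF
  obtain ⟨s, hs, hbad⟩ := not_tendsto_iff_exists_frequently_notMem.1 hF
  obtain ⟨p, hp, hps⟩ := exists_seq_forall_of_frequently hbad
  have hp1 : Tendsto (fun n => (p n).1) atTop atTop := tendsto_fst.comp hp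
  have hp2 : Tendsto (fun n => (p n).2) atTop (𝓝 0) := tendsto_snd.comp hp
  let u : ℝ≥0 → ℝ≥0 := fun t => if ht : ∃ n, (p n).1 = t then (p ht.choose).2 else 0
  have hu : Tendsto u atTop (𝓝 0) := by
    intro w hw
    obtain ⟨N, hN⟩ := eventually_atTop.1 (hp2.eventually_mem hw)
    have hlarge : ∀ᶠ t : ℝ≥0 in atTop, ∀ n ∈ Finset.range N, (p n).1 < t :=
      (eventually_all_finset _).2 fun n _ => eventually_gt_atTop _
    change ∀ᶠ t in atTop, u t ∈ w
    filter_upwards [hlarge] with t ht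
    by_cases hex : ∃ n, (p n).1 = t
    · simp only [u, dif_pos hex]
      refine hN _ (not_lt.1 fun hlt => ?_)
      exact (ht _ (Finset.mem_range.2 hlt)).ne hex.choose_spec
    · simpa only [u, dif_neg hex] using mem_of_mem_nhds hw
  obtain ⟨n, hn⟩ := (hp1.eventually ((h u hu).eventually_mem hs)).exists
  have hex : ∃ k, (p k).1 = (p n).1 := ⟨n, rfl⟩
  simp only [u, dif_pos hex] at hn
  have hspec := hps hex.choose
  rw [hex.choose_spec] at hspec
  exact hspec hn

/-- Rescaled test functions are integrable against finite measures. -/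
theorem integrable_comp_div (f : C(ℝ≥0∞, ℝ)) (t : ℝ≥0) (μ : Measure ℝ≥0) [IsFiniteMeasure μ] :
    Integrable (fun x : ℝ≥0 => f ((x / t : ℝ≥0) : ℝ≥0∞)) μ := by
  refine Integrable.of_bound (C := ‖f‖) ?_ (ae_of_all _ fun x => f.norm_coe_le_norm _)
  refine (f.continuous.comp (ENNReal.continuous_coe.comp ?_)).aestronglyMeasurable
  exact continuous_id.div_const t

/-- The regularity condition is stable under composition of Markov kernels. -/
theorem RegCond.comp {K L : Kernel ℝ≥0 ℝ≥0} [IsMarkovKernel K] [IsMarkovKernel L]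
    (hK : RegCond K) (hL : RegCond L) : RegCond (K ∘ₖ L) := by
  intro u hu f
  have hjoint : Tendsto (fun p : ℝ≥0 × ℝ≥0 =>
      ∫ x, f ((x / p.1 : ℝ≥0) : ℝ≥0∞) ∂(K (p.1 * p.2))) (atTop ×ˢ 𝓝 0) (𝓝 (f 0)) :=
    tendsto_prod_of_forall_selection
      (F := fun t v => ∫ x, f ((x / t : ℝ≥0) : ℝ≥0∞) ∂(K (t * v))) fun u hu => hK u hu f
  rw [Metric.tendsto_nhds]
  intro ε hε
  obtain ⟨pa, hpa, pb, hpb, hab⟩ :=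
    eventually_prod_iff.1 (Metric.tendsto_nhds.1 hjoint (ε / 2) (half_pos hε))
  obtain ⟨δ, hδ, hδb⟩ := exists_Ico_subset_of_mem_nhds hpb ⟨1, one_pos⟩
  obtain ⟨g, hg0, hg1, hg⟩ := exists_continuous_zero_one_of_isClosed
    (isClosed_singleton (x := (0 : ℝ≥0∞))) (isClosed_Ici (a := (δ : ℝ≥0∞)))
    (by simpa using hδ.ne')
  have hg0' : g 0 = 0 := hg0 rfl
  have hgL := hL u hu g
  rw [hg0'] at hgL
  have hsmall : ∀ᶠ t : ℝ≥0 in atTop,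
      ε / 2 + 2 * ‖f‖ * ∫ x, g ((x / t : ℝ≥0) : ℝ≥0∞) ∂(L (t * u t)) < ε := by
    have := (hgL.const_mul (2 * ‖f‖)).const_add (ε / 2)
    refine this.eventually_lt_const ?_
    simpa using hε
  filter_upwards [hsmall, hpa, eventually_gt_atTop 0] with t hts hta ht0
  have hbound : ∀ v : ℝ≥0, ‖(∫ x, f ((x / t : ℝ≥0) : ℝ≥0∞) ∂(K v)) - f 0‖ ≤
      ε / 2 + 2 * ‖f‖ * g ((v / t : ℝ≥0) : ℝ≥0∞) := by
    intro v
    rcases lt_or_ge (v / t) δ with hv | hv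
    · have hclose := hab hta (hδb ⟨zero_le, hv⟩)
      rw [mul_div_cancel₀ v ht0.ne', Real.dist_eq] at hclose
      have := mul_nonneg (mul_nonneg zero_le_two (norm_nonneg f))
        (hg ((v / t : ℝ≥0) : ℝ≥0∞)).1
      rw [Real.norm_eq_abs]
      linarith
    · have hone : g ((v / t : ℝ≥0) : ℝ≥0∞) = 1 := hg1 (ENNReal.coe_le_coe.2 hv)
      have hint : ‖∫ x, f ((x / t : ℝ≥0) : ℝ≥0∞) ∂(K v)‖ ≤ ‖f‖ := by
        simpa using norm_integral_le_of_norm_le_const (μ := K v)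
          (ae_of_all _ fun x : ℝ≥0 => f.norm_coe_le_norm ((x / t : ℝ≥0) : ℝ≥0∞))
      have h0 := f.norm_coe_le_norm 0
      have := norm_sub_le (∫ x, f ((x / t : ℝ≥0) : ℝ≥0∞) ∂(K v)) (f 0)
      rw [hone]
      linarith
  have hcomp := integrable_comp_div f t ((K ∘ₖ L) (t * u t))
  have hG : Integrable (fun v => ∫ x, f ((x / t : ℝ≥0) : ℝ≥0∞) ∂(K v)) (L (t * u t)) :=
    hcomp.integral_comp
  have hgi := integrable_comp_div g t (L (t * u t))
  rw [Kernel.integral_comp hcomp, dist_eq_norm]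
  calc ‖(∫ v, ∫ x, f ((x / t : ℝ≥0) : ℝ≥0∞) ∂(K v) ∂(L (t * u t))) - f 0‖
      = ‖∫ v, ((∫ x, f ((x / t : ℝ≥0) : ℝ≥0∞) ∂(K v)) - f 0) ∂(L (t * u t))‖ := by
        rw [integral_sub hG (integrable_const _)]
        simp
    _ ≤ ∫ v, (ε / 2 + 2 * ‖f‖ * g ((v / t : ℝ≥0) : ℝ≥0∞)) ∂(L (t * u t)) :=
        norm_integral_le_of_norm_le ((integrable_const _).add (hgi.const_mul _))
          (ae_of_all _ hbound)
    _ = ε / 2 + 2 * ‖f‖ * ∫ v, g ((v / t : ℝ≥0) : ℝ≥0∞) ∂(L (t * u t)) := by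
        rw [integral_add (integrable_const _) (hgi.const_mul _), integral_const_mul]
        simp
    _ < ε := hts

instance isMarkovKernel_kpow (K : Kernel ℝ≥0 ℝ≥0) [IsMarkovKernel K] (m : ℕ) :
    IsMarkovKernel (kpow K m) := by
  induction m with
  | zero => exact inferInstanceAs (IsMarkovKernel Kernel.id)
  | succ n ih => exact inferInstanceAs (IsMarkovKernel (K ∘ₖ kpow K n))

/-- If `K` satisfies the regularity condition, then so does every `m`-step transition
kernel `K^m`, `m ≥ 1`. -/
theorem regularity_m_step (K : Kernel ℝ≥0 ℝ≥0) [IsMarkovKernel K] (hK : RegCond K) :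
    ∀ m : ℕ, 1 ≤ m → RegCond (kpow K m) := by
  intro m hm
  induction m, hm using Nat.le_induction with
  | base => simpa [kpow] using hK
  | succ n _ ih => exact hK.comp ih
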